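/- For every resource expression e and every rigid representation r ◁ e, the multiplicity m(e) equals the cardinality of the automorphism group of r in the groupoid of permutation expressions: m(e) = Card(D(r)) (resp. Card(D^!(r)) when e is a monomial). -/

import Mathlib

set_option maxHeartbeats 1000000

/-! ### Rigid resource terms -/

/-- Rigid resource terms (de Bruijn indices for variables):
`a ::= x | λ.a | ⟨a⟩b⃗ | a⊕• | •⊕a` where argument lists are ordered. -/
inductive Rt : Type
  | var : ℕ → Rt
  | lam : Rt → Rt
  | app : Rt → List Rt → Rt
  | inl : Rt → Rt
  | inr : Rt → Rt
deriving Inhabited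

/-- Rigid resource expressions: terms or (rigid) monomials. -/
abbrev REx : Type := Rt ⊕ List Rt

/-! ### Permutation expressions -/

/-- Permutation expressions: rigid expressions with a permutation attached to
each list of arguments. -/
inductive PE : Type
  | var : ℕ → PE
  | lam : PE → PE
  | inl : PE → PE
  | inr : PE → PE
  | app : PE → PE → PE
  | mon : (n : ℕ) → Equiv.Perm (Fin n) → List PE → PE

mutual
  /-- `Maps ε a a'` means that the permutation expression `ε` maps the rigid
  term `a` to the rigid term `a'`, i.e. `ε : a ≅ a'`. -/
  inductive Maps : PE → Rt → Rt → Prop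
    | var (x : ℕ) : Maps (.var x) (.var x) (.var x)
    | lam {α a a'} : Maps α a a' → Maps (.lam α) (.lam a) (.lam a')
    | inl {α a a'} : Maps α a a' → Maps (.inl α) (.inl a) (.inl a')
    | inr {α a a'} : Maps α a a' → Maps (.inr α) (.inr a) (.inr a')
    | app {γ δ : PE} {c c' : Rt} {ds ds' : List Rt} :
        Maps γ c c' → MapsM δ ds ds' → Maps (.app γ δ) (.app c ds) (.app c' ds')
  /-- `MapsM δ b⃗ b⃗'` means that the permutation monomial `δ = (σ,α₁,…,αₙ)`
  maps the rigid monomial `b⃗` to `b⃗'`, with `αᵢ : bᵢ ≅ b'_{σ(i)}`. -/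
  inductive MapsM : PE → List Rt → List Rt → Prop
    | mon {n : ℕ} (σ : Equiv.Perm (Fin n)) (αs : List PE) (as as' : List Rt)
        (hα : αs.length = n) (ha : as.length = n) (ha' : as'.length = n)
        (H : ∀ i : Fin n,
          Maps (αs.get (i.cast hα.symm)) (as.get (i.cast ha.symm))
            (as'.get ((σ i).cast ha'.symm))) :
        MapsM (.mon n σ αs) as as'
end

/-- `ε : r ≅ r'` at the level of rigid expressions. -/
def MapsE : PE → REx → REx → Prop
  | ε, .inl a, .inl a' => Maps ε a a'
  | δ, .inr l, .inr l' => MapsM δ l l'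
  | _, _, _ => False

/-! ### Isomorphism of rigid expressions, via permutation expressions -/

/-- Two rigid terms are isomorphic (`≅`) when some permutation expression maps
one to the other. -/
def IsoT (a a' : Rt) : Prop := ∃ ε : PE, Maps ε a a'

/-- Isomorphism of rigid monomials. -/
def IsoM (l l' : List Rt) : Prop := ∃ δ : PE, MapsM δ l l'

/-- Isomorphism of rigid expressions. -/
def IsoE (r r' : REx) : Prop := ∃ ε : PE, MapsE ε r r'

/-! ### Resource expressions as quotients of rigid expressions -/

/-- Resource terms: rigid terms up to permutations of arguments, i.e. terms
whose argument lists are multisets. -/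
def ResTerm : Type := Quot IsoT

instance : Inhabited ResTerm := ⟨Quot.mk _ (.var 0)⟩

/-- The resource term represented by a rigid term (`r ◁ |r|`). -/
def rmk : Rt → ResTerm := Quot.mk IsoT

/-- A choice of rigid representation of a resource term. -/
noncomputable def rout : ResTerm → Rt := Quot.out

/-- The resource monomial (multiset) represented by a rigid monomial (list). -/
def toMul (bs : List Rt) : Multiset ResTerm := ↑(bs.map rmk)

/-- Resource expressions: terms or monomials (finite multisets of terms). -/
abbrev ResExpr : Type := ResTerm ⊕ Multiset ResTerm

/-- The resource expression represented by a rigid expression. -/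
def toQ : REx → ResExpr := Sum.map rmk toMul

/-- A choice of rigid representation of a resource expression. -/
noncomputable def outE : ResExpr → REx :=
  Sum.map rout (fun m => m.toList.map rout)

/-- Variable as a resource term. -/
def qVar (x : ℕ) : ResTerm := rmk (.var x)

/-- Abstraction on resource terms. -/
noncomputable def qLam (s : ResTerm) : ResTerm := rmk (.lam (rout s))

/-- Left injection `(-) ⊕ •` on resource terms. -/
noncomputable def qInl (s : ResTerm) : ResTerm := rmk (.inl (rout s))

/-- Right injection `• ⊕ (-)` on resource terms. -/
noncomputable def qInr (s : ResTerm) : ResTerm := rmk (.inr (rout s))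

/-- Application `⟨s⟩t̄` of a resource term to a resource monomial. -/
noncomputable def qApp (s : ResTerm) (t : Multiset ResTerm) : ResTerm :=
  rmk (.app (rout s) (t.toList.map rout))

/-! ### Multiplicity coefficients -/

/-- The factor `∏ᵢ kᵢ!` of the multiplicity of a rigid monomial, where the `kᵢ`
are the multiplicities of the pairwise distinct resource terms represented in it. -/
noncomputable def stabFac (bs : List Rt) : ℕ :=
  letI := Classical.decEq ResTerm
  (toMul bs).toFinset.prod fun t => Nat.factorial ((toMul bs).count t)

/-- Multiplicity coefficient of a rigid term; for a monomial representing
`[t₁]^{k₁}·…·[tₚ]^{kₚ}` (the `tᵢ` pairwise distinct) the factor contributed is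
`∏ᵢ kᵢ! · m(tᵢ)^{kᵢ} = (∏ᵢ kᵢ!) · ∏_{b ∈ b⃗} m(b)`. -/
noncomputable def mRig : Rt → ℕ
  | .var _ => 1
  | .lam a => mRig a
  | .inl a => mRig a
  | .inr a => mRig a
  | .app c ds => mRig c * (stabFac ds * (ds.attach.map fun e => mRig e.1).prod)
termination_by r => sizeOf r
decreasing_by
  all_goals simp_wf
  all_goals try omega
  all_goals (have := List.sizeOf_lt_of_mem e.2; omega)

/-- Multiplicity coefficient `m(s)` of a resource term. -/
noncomputable def mT (s : ResTerm) : ℕ := mRig (rout s)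

/-- Multiplicity coefficient `m(t̄) = ∏ᵢ kᵢ! · m(tᵢ)^{kᵢ}` of a resource
monomial `[t₁]^{k₁}·…·[tₚ]^{kₚ}` with the `tᵢ` pairwise distinct. -/
noncomputable def mMon (m : Multiset ResTerm) : ℕ :=
  letI := Classical.decEq ResTerm
  m.toFinset.prod fun t => Nat.factorial (m.count t) * (mT t) ^ (m.count t)

/-- Multiplicity coefficient of a resource expression. -/
noncomputable def mE : ResExpr → ℕ := Sum.elim mT mMon

/-! ### Permutation expressions between tuples -/

theorem MapsM.length_eq {δ : PE} {as as' : List Rt} (h : MapsM δ as as') :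
    as.length = as'.length := by
  cases h with
  | mon σ αs _ _ hα ha ha' H => rw [ha, ha']

theorem mapsM_ofFn_iff {n : ℕ} {f g : Fin n → Rt} {δ : PE} :
    MapsM δ (List.ofFn f) (List.ofFn g) ↔
      ∃ (σ : Equiv.Perm (Fin n)) (α : Fin n → PE),
        δ = .mon n σ (List.ofFn α) ∧ ∀ i, Maps (α i) (f i) (g (σ i)) := by
  constructor
  · intro h
    cases h with
    | @mon m σ αs _ _ hα ha ha' H =>
      obtain rfl : n = m := by simpa using ha
      refine ⟨σ, fun i => αs.get (i.cast hα.symm), ?_, fun i => by simpa using H i⟩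
      congr 1
      apply List.ext_get <;> simp [hα]
  · rintro ⟨σ, α, rfl, H⟩
    exact .mon σ _ _ _ (by simp) (by simp) (by simp) fun i => by simpa using H i

theorem isoM_ofFn_iff {n : ℕ} {f g : Fin n → Rt} :
    IsoM (List.ofFn f) (List.ofFn g) ↔
      ∃ σ : Equiv.Perm (Fin n), ∀ i, IsoT (f i) (g (σ i)) := by
  simp only [IsoM, mapsM_ofFn_iff]
  constructor
  · rintro ⟨_, σ, α, rfl, H⟩
    exact ⟨σ, fun i => ⟨α i, H i⟩⟩
  · rintro ⟨σ, H⟩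
    choose α H using H
    exact ⟨_, σ, α, rfl, H⟩

theorem IsoM.exists_ofFn {as as' : List Rt} (h : IsoM as as') :
    ∃ (n : ℕ) (f g : Fin n → Rt), as = List.ofFn f ∧ as' = List.ofFn g := by
  obtain ⟨δ, h⟩ := h
  refine ⟨as.length, as.get, fun i => as'.get (i.cast h.length_eq), by simp, ?_⟩
  apply List.ext_get <;> simp [h.length_eq]

theorem isoT_app_iff {c c' : Rt} {ds ds' : List Rt} :
    IsoT (.app c ds) (.app c' ds') ↔ IsoT c c' ∧ IsoM ds ds' := by
  constructor
  · rintro ⟨_, h⟩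
    cases h with
    | app h h' => exact ⟨⟨_, h⟩, ⟨_, h'⟩⟩
  · rintro ⟨⟨_, h⟩, ⟨_, k⟩⟩
    exact ⟨_, .app h k⟩

/-- Induction on rigid terms, with argument lists presented as tuples. -/
theorem Rt.induction_ofFn {P : Rt → Prop} (var : ∀ x, P (.var x))
    (lam : ∀ a, P a → P (.lam a)) (inl : ∀ a, P a → P (.inl a)) (inr : ∀ a, P a → P (.inr a))
    (app : ∀ c (n : ℕ) (f : Fin n → Rt), P c → (∀ i, P (f i)) → P (.app c (List.ofFn f))) :
    ∀ a, P a
  | .var x => var x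
  | .lam a => lam a (Rt.induction_ofFn var lam inl inr app a)
  | .inl a => inl a (Rt.induction_ofFn var lam inl inr app a)
  | .inr a => inr a (Rt.induction_ofFn var lam inl inr app a)
  | .app c ds => by
    have h := app c ds.length ds.get (Rt.induction_ofFn var lam inl inr app c)
      fun i => Rt.induction_ofFn var lam inl inr app (ds.get i)
    rwa [List.ofFn_get] at h
termination_by a => sizeOf a
decreasing_by
  all_goals simp_wf
  all_goals try omega
  have := List.sizeOf_lt_of_mem (List.getElem_mem i.2)
  omega

/-- Induction on pairs of isomorphic rigid terms. -/
theorem IsoT.induction_ofFn {P : Rt → Rt → Prop} (var : ∀ x, P (.var x) (.var x))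
    (lam : ∀ a a', IsoT a a' → P a a' → P (.lam a) (.lam a'))
    (inl : ∀ a a', IsoT a a' → P a a' → P (.inl a) (.inl a'))
    (inr : ∀ a a', IsoT a a' → P a a' → P (.inr a) (.inr a'))
    (app : ∀ c c' (n : ℕ) (f g : Fin n → Rt) (σ : Equiv.Perm (Fin n)), IsoT c c' → P c c' →
      (∀ i, IsoT (f i) (g (σ i))) → (∀ i, P (f i) (g (σ i))) →
      P (.app c (List.ofFn f)) (.app c' (List.ofFn g)))
    (a : Rt) : ∀ {a'}, IsoT a a' → P a a' := by
  induction a using Rt.induction_ofFn with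
  | var x =>
    rintro _ ⟨_, h⟩
    cases h
    exact var x
  | lam a ih =>
    rintro _ ⟨_, h⟩
    cases h with
    | lam h => exact lam _ _ ⟨_, h⟩ (ih ⟨_, h⟩)
  | inl a ih =>
    rintro _ ⟨_, h⟩
    cases h with
    | inl h => exact inl _ _ ⟨_, h⟩ (ih ⟨_, h⟩)
  | inr a ih =>
    rintro _ ⟨_, h⟩
    cases h with
    | inr h => exact inr _ _ ⟨_, h⟩ (ih ⟨_, h⟩)
  | app c n f ihc ihf =>
    rintro _ ⟨_, h⟩
    cases h with
    | @app _ _ _ c' _ ds' h h' =>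
      obtain ⟨m, f', g, hf, rfl⟩ := IsoM.exists_ofFn ⟨_, h'⟩
      obtain rfl : n = m := by simpa using congrArg List.length hf
      obtain ⟨σ, hσ⟩ := isoM_ofFn_iff.1 ⟨_, h'⟩
      exact app _ _ _ _ _ σ ⟨_, h⟩ (ihc ⟨_, h⟩) hσ fun i => ihf i (hσ i)

/-! ### Isomorphism is an equivalence relation -/

theorem IsoT.refl (a : Rt) : IsoT a a := by
  induction a using Rt.induction_ofFn with
  | var x => exact ⟨_, .var x⟩
  | lam a ih => exact ih.imp' _ fun _ => .lam
  | inl a ih => exact ih.imp' _ fun _ => .inl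
  | inr a ih => exact ih.imp' _ fun _ => .inr
  | app c n f ihc ihf => exact isoT_app_iff.2 ⟨ihc, isoM_ofFn_iff.2 ⟨1, ihf⟩⟩

theorem IsoT.symm {a a' : Rt} (h : IsoT a a') : IsoT a' a := by
  refine IsoT.induction_ofFn (P := fun a a' => IsoT a' a) (fun x => .refl _)
    (fun _ _ _ ih => ih.imp' _ fun _ => .lam) (fun _ _ _ ih => ih.imp' _ fun _ => .inl)
    (fun _ _ _ ih => ih.imp' _ fun _ => .inr) ?_ a h
  intro c c' n f g σ _ ihc _ ihf
  exact isoT_app_iff.2 ⟨ihc, isoM_ofFn_iff.2 ⟨σ.symm, fun i => by simpa using ihf (σ.symm i)⟩⟩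

theorem IsoT.trans {a b c : Rt} (h : IsoT a b) (h' : IsoT b c) : IsoT a c := by
  revert c
  refine IsoT.induction_ofFn (P := fun a b => ∀ {c}, IsoT b c → IsoT a c) (fun x _ h => h)
    ?_ ?_ ?_ ?_ a h
  · rintro _ _ _ ih _ ⟨_, h'⟩
    cases h' with
    | lam h' => exact (ih ⟨_, h'⟩).imp' _ fun _ => .lam
  · rintro _ _ _ ih _ ⟨_, h'⟩
    cases h' with
    | inl h' => exact (ih ⟨_, h'⟩).imp' _ fun _ => .inl
  · rintro _ _ _ ih _ ⟨_, h'⟩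
    cases h' with
    | inr h' => exact (ih ⟨_, h'⟩).imp' _ fun _ => .inr
  · rintro _ _ n f g σ _ ihc _ ihf _ ⟨_, h'⟩
    cases h' with
    | app h h' =>
      obtain ⟨m, g', k, hg, rfl⟩ := IsoM.exists_ofFn ⟨_, h'⟩
      obtain rfl : n = m := by simpa using congrArg List.length hg
      obtain ⟨τ, hτ⟩ := isoM_ofFn_iff.1 ⟨_, h'⟩
      exact isoT_app_iff.2
        ⟨ihc ⟨_, h⟩, isoM_ofFn_iff.2 ⟨σ.trans τ, fun i => ihf i (hτ (σ i))⟩⟩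

theorem rmk_eq_iff {a a' : Rt} : rmk a = rmk a' ↔ IsoT a a' :=
  Quot.eq.trans <| Equivalence.eqvGen_iff ⟨IsoT.refl, IsoT.symm, IsoT.trans⟩

theorem isoT_rout_rmk (a : Rt) : IsoT (rout (rmk a)) a :=
  rmk_eq_iff.1 (Quot.out_eq _)

/-! ### Multiplicities of rigid terms -/

theorem toMul_ofFn {n : ℕ} (f : Fin n → Rt) :
    toMul (List.ofFn f) = Finset.univ.val.map fun i => rmk (f i) := by
  rw [Fin.univ_val_map, toMul, List.map_ofFn]
  rfl

theorem toMul_ofFn_eq_of_perm {n : ℕ} {f g : Fin n → Rt} (σ : Equiv.Perm (Fin n))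
    (h : ∀ i, IsoT (f i) (g (σ i))) : toMul (List.ofFn f) = toMul (List.ofFn g) := by
  simp only [toMul_ofFn, fun i => rmk_eq_iff.2 (h i)]
  conv_rhs => rw [← Multiset.map_univ_val_equiv σ, Multiset.map_map]
  rfl

theorem mRig_app (c : Rt) (ds : List Rt) :
    mRig (.app c ds) = mRig c * (stabFac ds * (ds.map mRig).prod) := by
  rw [mRig, List.attach_map_val]

theorem stabFac_pos (bs : List Rt) : 0 < stabFac bs :=
  Finset.prod_pos fun _ _ => Nat.factorial_pos _

theorem mRig_pos (a : Rt) : 0 < mRig a := by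
  induction a using Rt.induction_ofFn with
  | var x => simp [mRig]
  | lam a ih | inl a ih | inr a ih => simpa [mRig] using ih
  | app c n f ihc ihf =>
    rw [mRig_app, List.map_ofFn, List.prod_ofFn]
    exact mul_pos ihc (mul_pos (stabFac_pos _) (Finset.prod_pos fun i _ => ihf i))

theorem IsoT.mRig_eq {a a' : Rt} (h : IsoT a a') : mRig a = mRig a' := by
  refine IsoT.induction_ofFn (P := fun a a' => mRig a = mRig a') (fun x => rfl)
    (fun _ _ _ ih => by simpa [mRig] using ih) (fun _ _ _ ih => by simpa [mRig] using ih)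
    (fun _ _ _ ih => by simpa [mRig] using ih) ?_ a h
  intro c c' n f g σ _ ihc hf ihf
  simp only [mRig_app, List.map_ofFn, List.prod_ofFn, Function.comp_apply, ihf, ihc, stabFac,
    toMul_ofFn_eq_of_perm σ hf, Equiv.prod_comp σ fun i => mRig (g i)]

theorem mT_rmk (a : Rt) : mT (rmk a) = mRig a :=
  (isoT_rout_rmk a).mRig_eq

theorem mMon_toMul (bs : List Rt) : mMon (toMul bs) = stabFac bs * (bs.map mRig).prod := by
  classical
  have h : (bs.map mRig).prod = ((toMul bs).map mT).prod := by
    simp [toMul, Function.comp_def, mT_rmk]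
  rw [h, Finset.prod_multiset_map_count, stabFac, mMon, Finset.prod_mul_distrib]

/-! ### Counting permutation expressions -/

/-- The permutations matching a finite family with one of its rearrangements are counted by the
factorials of the multiplicities of its values. -/
theorem card_perm_eq_prod_factorial_count {ι β : Type*} [Fintype ι] [DecidableEq ι]
    [DecidableEq β] {F G : ι → β} {σ₀ : Equiv.Perm ι} (h₀ : ∀ i, F i = G (σ₀ i)) :
    Nat.card {σ : Equiv.Perm ι // ∀ i, F i = G (σ i)} =
      ∏ b ∈ (Finset.univ.val.map F).toFinset, ((Finset.univ.val.map F).count b).factorial := by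
  have e : {σ : Equiv.Perm ι // ∀ i, F i = G (σ i)} ≃ {τ : Equiv.Perm ι // F ∘ τ = F} :=
    (Equiv.mulLeft σ₀⁻¹).subtypeEquiv fun σ => by
      simp [funext_iff, h₀, eq_comm]
  rw [Nat.card_congr e, Nat.card_eq_fintype_card, DomMulAct.stabilizer_card']
  refine Finset.prod_congr (by ext; simp) fun b _ => ?_
  rw [Multiset.count_map, Fintype.card_subtype, Finset.card_def, Finset.filter_val]
  simp only [eq_comm]

/-- A permutation expression between tuples is a permutation together with a tuple of permutation
expressions. -/
noncomputable def mapsMOfFnEquiv {n : ℕ} (f g : Fin n → Rt) :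
    (Σ σ : Equiv.Perm (Fin n), ∀ i, {α : PE // Maps α (f i) (g (σ i))}) ≃
      {δ : PE // MapsM δ (List.ofFn f) (List.ofFn g)} :=
  Equiv.ofBijective
    (fun p => ⟨.mon n p.1 (List.ofFn fun i => (p.2 i).1),
      mapsM_ofFn_iff.2 ⟨_, _, rfl, fun i => (p.2 i).2⟩⟩) <| by
    constructor
    · rintro ⟨σ, α⟩ ⟨τ, β⟩ h
      simp only [Subtype.mk.injEq, PE.mon.injEq, heq_eq_eq, true_and, List.ofFn_inj] at h
      obtain ⟨rfl, h⟩ := h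
      congr 1
      funext i
      exact Subtype.ext (congrFun h i)
    · rintro ⟨_, h⟩
      obtain ⟨σ, α, rfl, H⟩ := mapsM_ofFn_iff.1 h
      exact ⟨⟨σ, fun i => ⟨α i, H i⟩⟩, rfl⟩

theorem card_mapsM_ofFn {n : ℕ} {f g : Fin n → Rt}
    (hf : ∀ i a', IsoT (f i) a' → Nat.card {α : PE // Maps α (f i) a'} = mRig (f i))
    (h : IsoM (List.ofFn f) (List.ofFn g)) :
    Nat.card {δ : PE // MapsM δ (List.ofFn f) (List.ofFn g)} =
      stabFac (List.ofFn f) * ((List.ofFn f).map mRig).prod := by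
  classical
  have hempty (i a') (h : ¬ IsoT (f i) a') : IsEmpty {α : PE // Maps α (f i) a'} :=
    ⟨fun α => h ⟨α.1, α.2⟩⟩
  have hfin (i a') : Finite {α : PE // Maps α (f i) a'} := by
    by_cases h : IsoT (f i) a'
    · exact Nat.finite_of_card_ne_zero ((hf i a' h).trans_ne (mRig_pos _).ne')
    · have := hempty i a' h
      infer_instance
  have hprod (σ : Equiv.Perm (Fin n)) :
      ∏ i, Nat.card {α : PE // Maps α (f i) (g (σ i))} =
        if ∀ i, rmk (f i) = rmk (g (σ i)) then ∏ i, mRig (f i) else 0 := by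
    simp only [rmk_eq_iff]
    split_ifs with h
    · exact Finset.prod_congr rfl fun i _ => hf i _ (h i)
    · obtain ⟨i, hi⟩ := not_forall.1 h
      have := hempty i _ hi
      exact Finset.prod_eq_zero (Finset.mem_univ i) Nat.card_of_isEmpty
  obtain ⟨σ₀, h₀⟩ := isoM_ofFn_iff.1 h
  have hcard := card_perm_eq_prod_factorial_count (F := fun i => rmk (f i))
    (G := fun i => rmk (g i)) fun i => rmk_eq_iff.2 (h₀ i)
  rw [← Nat.card_congr (mapsMOfFnEquiv f g), Nat.card_sigma]
  simp only [Nat.card_pi, hprod]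
  rw [← Finset.sum_filter, Finset.sum_const, smul_eq_mul, ← Fintype.card_subtype,
    ← Nat.card_eq_fintype_card, hcard, List.map_ofFn, List.prod_ofFn, stabFac, toMul_ofFn]
  congr!

theorem card_maps (a : Rt) :
    ∀ a', IsoT a a' → Nat.card {ε : PE // Maps ε a a'} = mRig a := by
  induction a using Rt.induction_ofFn with
  | var x =>
    rintro _ ⟨_, h⟩
    cases h
    rw [mRig, Nat.card_eq_one_iff_unique]
    refine ⟨⟨fun ⟨_, h⟩ ⟨_, h'⟩ => ?_⟩, ⟨_, .var x⟩⟩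
    cases h
    cases h'
    rfl
  | lam a ih =>
    rintro _ ⟨_, h⟩
    cases h with
    | @lam _ _ a' h =>
      rw [mRig, ← ih a' ⟨_, h⟩]
      refine (Nat.card_congr <| .ofBijective (fun α => ⟨.lam α.1, .lam α.2⟩) ⟨?_, ?_⟩).symm
      · rintro ⟨α, _⟩ ⟨β, _⟩ h
        simpa using h
      · rintro ⟨_, h⟩
        cases h with
        | lam h => exact ⟨⟨_, h⟩, rfl⟩
  | inl a ih =>
    rintro _ ⟨_, h⟩
    cases h with
    | @inl _ _ a' h =>
      rw [mRig, ← ih a' ⟨_, h⟩]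
      refine (Nat.card_congr <| .ofBijective (fun α => ⟨.inl α.1, .inl α.2⟩) ⟨?_, ?_⟩).symm
      · rintro ⟨α, _⟩ ⟨β, _⟩ h
        simpa using h
      · rintro ⟨_, h⟩
        cases h with
        | inl h => exact ⟨⟨_, h⟩, rfl⟩
  | inr a ih =>
    rintro _ ⟨_, h⟩
    cases h with
    | @inr _ _ a' h =>
      rw [mRig, ← ih a' ⟨_, h⟩]
      refine (Nat.card_congr <| .ofBijective (fun α => ⟨.inr α.1, .inr α.2⟩) ⟨?_, ?_⟩).symm
      · rintro ⟨α, _⟩ ⟨β, _⟩ h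
        simpa using h
      · rintro ⟨_, h⟩
        cases h with
        | inr h => exact ⟨⟨_, h⟩, rfl⟩
  | app c n f ihc ihf =>
    rintro _ ⟨_, h⟩
    cases h with
    | @app _ _ _ c' _ ds' h h' =>
      obtain ⟨m, f', g, hf, rfl⟩ := IsoM.exists_ofFn ⟨_, h'⟩
      obtain rfl : n = m := by simpa using congrArg List.length hf
      rw [mRig_app, ← ihc c' ⟨_, h⟩, ← card_mapsM_ofFn ihf ⟨_, h'⟩, ← Nat.card_prod]
      refine (Nat.card_congr <| .ofBijective
        (fun p => ⟨.app p.1.1 p.2.1, .app p.1.2 p.2.2⟩) ⟨?_, ?_⟩).symm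
      · rintro ⟨⟨α, _⟩, ⟨β, _⟩⟩ ⟨⟨α', _⟩, ⟨β', _⟩⟩ h
        simpa using h
      · rintro ⟨_, h⟩
        cases h with
        | app h h' => exact ⟨⟨⟨_, h⟩, ⟨_, h'⟩⟩, rfl⟩

theorem IsoM.refl (bs : List Rt) : IsoM bs bs := by
  rw [← List.ofFn_get bs]
  exact isoM_ofFn_iff.2 ⟨1, fun i => .refl _⟩

theorem card_mapsM (bs : List Rt) :
    Nat.card {δ : PE // MapsM δ bs bs} = stabFac bs * (bs.map mRig).prod := by
  have h := card_mapsM_ofFn (fun i => card_maps (bs.get i)) (IsoM.refl _)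
  rwa [List.ofFn_get] at h

/-! ### STATEMENT 10:
For every resource expression `e` and every rigid representation `r ◁ e`, the
multiplicity `m(e)` equals the cardinality of the automorphism group of `r` in
the groupoid of permutation expressions. -/
theorem multiplicity_eq_card_automorphisms :
    (∀ (e : ResTerm) (r : Rt), rmk r = e → mT e = Nat.card {ε : PE // Maps ε r r}) ∧
    (∀ (t : Multiset ResTerm) (bs : List Rt), toMul bs = t →
      mMon t = Nat.card {δ : PE // MapsM δ bs bs}) := by
  refine ⟨?_, ?_⟩
  · rintro _ r rfl
    rw [mT_rmk, card_maps r r (.refl r)]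
  · rintro _ bs rfl
    rw [mMon_toMul, card_mapsM]
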